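/- Let P : X ↛ Y and Q : Y ↛ Z be open Petri nets. If (x, y) ∈ ■P and (y, z) ∈ ■Q, then (x, z) ∈ ■(Q ⊙ P). Hence the composite relation ■Q ∘ ■P = {(x, z) : ∃ y ∈ ℕ[Y], (x, y) ∈ ■P and (y, z) ∈ ■Q} is contained in ■(Q ⊙ P). -/

import Mathlib

universe u

structure PetriNet : Type (u + 1) where
  T : Type u
  S : Type u
  src : T → Multiset S
  tgt : T → Multiset S

def PetriNet.Fires (P : PetriNet.{u}) (τ : P.T) (m n : Multiset P.S) : Prop :=
  P.src τ ≤ m ∧ n + P.src τ = m + P.tgt τ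

inductive PetriNet.Reachable (P : PetriNet.{u}) : Multiset P.S → Multiset P.S → Prop
  | refl (m : Multiset P.S) : PetriNet.Reachable P m m
  | step {m m' n : Multiset P.S} (τ : P.T) :
      P.Fires τ m m' → PetriNet.Reachable P m' n → PetriNet.Reachable P m n

/-- An open Petri net `P : X ↛ Y`: a Petri net together with functions from `X` and `Y`
into its set of places. -/
structure OpenPetri (X Y : Type u) : Type (u + 1) where
  net : PetriNet.{u}
  i : X → net.S
  o : Y → net.S

/-- The reachability relation `■P ⊆ ℕ[X] × ℕ[Y]` of an open Petri net. -/
def OpenPetri.bsq {X Y : Type u} (P : OpenPetri X Y) : Set (Multiset X × Multiset Y) :=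
  {p | P.net.Reachable (p.1.map P.i) (p.2.map P.o)}

/-- The pushout `S_P +_Y S_Q` of the places of `P` and `Q` along `Y`. -/
def OpenPetri.Glue {X Y Z : Type u} (P : OpenPetri X Y) (Q : OpenPetri Y Z) : Type u :=
  Quot (fun (a b : P.net.S ⊕ Q.net.S) => ∃ y : Y, a = Sum.inl (P.o y) ∧ b = Sum.inr (Q.i y))

/-- The composite `Q ⊙ P : X ↛ Z` of open Petri nets, formed by gluing the outputs of `P`
to the inputs of `Q` along `Y` (a pushout of the sets of places). -/
def OpenPetri.comp {X Y Z : Type u} (P : OpenPetri X Y) (Q : OpenPetri Y Z) :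
    OpenPetri X Z where
  net :=
    { T := P.net.T ⊕ Q.net.T
      S := P.Glue Q
      src := Sum.elim (fun τ => (P.net.src τ).map (fun s => Quot.mk _ (Sum.inl s)))
        (fun τ => (Q.net.src τ).map (fun s => Quot.mk _ (Sum.inr s)))
      tgt := Sum.elim (fun τ => (P.net.tgt τ).map (fun s => Quot.mk _ (Sum.inl s)))
        (fun τ => (Q.net.tgt τ).map (fun s => Quot.mk _ (Sum.inr s))) }
  i := fun x => Quot.mk _ (Sum.inl (P.i x))
  o := fun z => Quot.mk _ (Sum.inr (Q.o z))


/-- A morphism of Petri nets, given by `f` on places and `g` on transitions, preserves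
reachability. -/
theorem PetriNet.Reachable.map {P Q : PetriNet.{u}} (f : P.S → Q.S) (g : P.T → Q.T)
    (hsrc : ∀ τ, Q.src (g τ) = (P.src τ).map f) (htgt : ∀ τ, Q.tgt (g τ) = (P.tgt τ).map f)
    {m n : Multiset P.S} (h : P.Reachable m n) : Q.Reachable (m.map f) (n.map f) := by
  induction h with
  | refl m => exact .refl _
  | step τ hτ _ ih =>
    refine .step (g τ) ⟨?_, ?_⟩ ih
    · rw [hsrc]
      exact Multiset.map_le_map hτ.1
    · rw [hsrc, htgt, ← Multiset.map_add, ← Multiset.map_add, hτ.2]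

theorem PetriNet.Reachable.trans {P : PetriNet.{u}} {l m n : Multiset P.S}
    (h₁ : P.Reachable l m) (h₂ : P.Reachable m n) : P.Reachable l n := by
  induction h₁ with
  | refl _ => exact h₂
  | step τ hτ _ ih => exact .step τ hτ (ih h₂)

theorem OpenPetri.mem_bsq_comp {X Y Z : Type u} {P : OpenPetri X Y} {Q : OpenPetri Y Z}
    {x : Multiset X} {y : Multiset Y} {z : Multiset Z}
    (hP : (x, y) ∈ P.bsq) (hQ : (y, z) ∈ Q.bsq) : (x, z) ∈ (P.comp Q).bsq := by
  let jP : P.net.S → (P.comp Q).net.S := fun s => Quot.mk _ (Sum.inl s)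
  let jQ : Q.net.S → (P.comp Q).net.S := fun s => Quot.mk _ (Sum.inr s)
  have glue : jP ∘ P.o = jQ ∘ Q.i := funext fun y => Quot.sound ⟨y, rfl, rfl⟩
  have h₁ : (P.comp Q).net.Reachable ((x.map P.i).map jP) ((y.map P.o).map jP) :=
    PetriNet.Reachable.map jP Sum.inl (fun _ => rfl) (fun _ => rfl) hP
  have h₂ : (P.comp Q).net.Reachable ((y.map Q.i).map jQ) ((z.map Q.o).map jQ) :=
    PetriNet.Reachable.map jQ Sum.inr (fun _ => rfl) (fun _ => rfl) hQ
  rw [Multiset.map_map, Multiset.map_map, glue] at h₁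
  rw [Multiset.map_map, Multiset.map_map] at h₂
  exact h₁.trans h₂

/-- If `(x, y) ∈ ■P` and `(y, z) ∈ ■Q`, then `(x, z) ∈ ■(Q ⊙ P)`;
hence the composite relation `■Q ∘ ■P` is contained in `■(Q ⊙ P)`. -/
theorem bsq_comp_sub {X Y Z : Type u} (P : OpenPetri X Y) (Q : OpenPetri Y Z) :
    (∀ (x : Multiset X) (y : Multiset Y) (z : Multiset Z),
      (x, y) ∈ P.bsq → (y, z) ∈ Q.bsq → (x, z) ∈ (P.comp Q).bsq) ∧
    {p : Multiset X × Multiset Z |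
        ∃ y : Multiset Y, (p.1, y) ∈ P.bsq ∧ (y, p.2) ∈ Q.bsq} ⊆ (P.comp Q).bsq := by
  exact ⟨fun _ _ _ hP hQ => OpenPetri.mem_bsq_comp hP hQ,
    fun _ ⟨_, hP, hQ⟩ => OpenPetri.mem_bsq_comp hP hQ⟩
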